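/- Let n ≥ 1, 0 < α < 2, and let (φ,ψ) be a parabolic Littlewood–Paley family on ℝ^{n+1}. There exist constants c, C > 0 (depending only on n, α, φ, ψ) such that for every Schwartz function f on ℝ^{n+1}: c·N_{α,∞}(f) ≤ ‖f‖_{L^∞(ℝ^{n+1})} + sup_{X, t ≠ s} |f(X,t) − f(X,s)|/|t−s|^{α/2} + sup_{X, t, Y ≠ 0} |f(X+Y,t) − 2f(X,t) + f(X−Y,t)|/|Y|^{α} ≤ C·N_{α,∞}(f), where N_{α,∞}(f) := max( ‖ψ*f‖_{L^∞}, sup_{i≥1} 2^{αi}‖φ_i*f‖_{L^∞} ). -/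

import Mathlib

noncomputable section

open MeasureTheory Real Complex
open scoped ENNReal NNReal Real BigOperators

/-- Euclidean space `ℝⁿ`. -/
abbrev Rn (n : ℕ) : Type := EuclideanSpace ℝ (Fin n)

/-- The space `ℝ^{n+1} = ℝⁿ × ℝ`, points written `(X, t)`. -/
abbrev Rn1 (n : ℕ) : Type := EuclideanSpace ℝ (Fin n) × ℝ

/-- Fourier transform on `ℝ^{n+1}`:
`𝓕f(ξ,τ) = ∫ e^{−2πi(X·ξ + tτ)} f(X,t) dX dt`. -/
def FT1 {n : ℕ} (f : Rn1 n → ℂ) (q : Rn1 n) : ℂ :=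
  ∫ p : Rn1 n,
    Complex.exp (-(2 * (π : ℂ) * Complex.I) *
      (((∑ k, p.1 k * q.1 k) + p.2 * q.2 : ℝ) : ℂ)) * f p

/-- Inverse Fourier transform on `ℝ^{n+1}`. -/
def IFT1 {n : ℕ} (f : Rn1 n → ℂ) (x : Rn1 n) : ℂ :=
  ∫ q : Rn1 n,
    Complex.exp ((2 * (π : ℂ) * Complex.I) *
      (((∑ k, q.1 k * x.1 k) + q.2 * x.2 : ℝ) : ℂ)) * f q

/-- The Fourier multiplier operator `f ↦ 𝓕⁻¹(m · 𝓕 f)` on `ℝ^{n+1}`. -/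
def MOp {n : ℕ} (m : Rn1 n → ℂ) (f : Rn1 n → ℂ) : Rn1 n → ℂ :=
  IFT1 (fun q => m q * FT1 f q)

/-- The symbol `m_α(ξ,τ) = (1 + 4π²|ξ|² + iτ)^{α/2}` (principal branch). -/
def mSym {n : ℕ} (α : ℝ) (q : Rn1 n) : ℂ :=
  (1 + 4 * (π : ℂ) ^ 2 * (‖q.1‖ : ℂ) ^ 2 + Complex.I * (q.2 : ℂ)) ^ ((α : ℂ) / 2)

/-- Partial derivative `∂_{X_k}`. -/
def dX {n : ℕ} (k : Fin n) (f : Rn1 n → ℂ) : Rn1 n → ℂ :=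
  fun x => fderiv ℝ f x (EuclideanSpace.single k 1, 0)

/-- Partial derivative `∂_t`. -/
def dT {n : ℕ} (f : Rn1 n → ℂ) : Rn1 n → ℂ :=
  fun x => fderiv ℝ f x (0, 1)

/-- Iterated spatial derivative `D_X^β` for a multi-index `β`. -/
def dXmulti {n : ℕ} (β : Fin n → ℕ) (f : Rn1 n → ℂ) : Rn1 n → ℂ :=
  (List.finRange n).foldr (fun k g => (dX k)^[β k] g) f

/-- The half time-derivative `D_t^{1/2} f = 𝓕⁻¹(|τ|^{1/2}·𝓕f)`. -/
def halfDt {n : ℕ} (f : Rn1 n → ℂ) : Rn1 n → ℂ :=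
  MOp (fun q => ((|q.2| ^ ((1 : ℝ) / 2) : ℝ) : ℂ)) f

/-- The `Lᵖ(ℝ^{n+1})` norm (as a value in `ℝ≥0∞`), `p` a real exponent. -/
def pNorm {n : ℕ} (p : ℝ) (f : Rn1 n → ℂ) : ℝ≥0∞ :=
  eLpNorm f (ENNReal.ofReal p) volume

/-- Multi-indices `β ∈ ℕⁿ` with `|β| = N`. -/
def multiIdx (n N : ℕ) : Finset (Fin n → ℕ) :=
  (Fintype.piFinset fun _ : Fin n => Finset.range (N + 1)).filter fun β => (∑ k, β k) = N

/-- Convolution on `ℝ^{n+1}`. -/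
def conv1 {n : ℕ} (g f : Rn1 n → ℂ) : Rn1 n → ℂ :=
  fun x => ∫ y : Rn1 n, g (x - y) * f y

/-- A parabolic Littlewood–Paley family on `ℝ^{n+1}`. -/
structure ParabolicLP (n : ℕ) where
  φ : SchwartzMap (Rn1 n) ℂ
  ψ : SchwartzMap (Rn1 n) ℂ
  ft_pos : ∀ q : Rn1 n,
    1 / 2 < ‖q.1‖ + |q.2| ^ ((1 : ℝ) / 2) → ‖q.1‖ + |q.2| ^ ((1 : ℝ) / 2) < 2 →
      0 < (FT1 (⇑φ) q).re ∧ (FT1 (⇑φ) q).im = 0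
  ft_supp : ∀ q : Rn1 n,
    ¬(1 / 2 < ‖q.1‖ + |q.2| ^ ((1 : ℝ) / 2) ∧ ‖q.1‖ + |q.2| ^ ((1 : ℝ) / 2) < 2) →
      FT1 (⇑φ) q = 0
  ft_sum : ∀ q : Rn1 n, q ≠ 0 →
    ∑' i : ℤ, FT1 (⇑φ) (((2 : ℝ) ^ (-i)) • q.1, ((2 : ℝ) ^ (-(2 * i))) * q.2) = 1
  ft_psi : ∀ q : Rn1 n,
    FT1 (⇑ψ) q =
      1 - ∑' i : ℕ,
        FT1 (⇑φ) (((2 : ℝ) ^ (-((i : ℤ) + 1))) • q.1, ((2 : ℝ) ^ (-(2 * ((i : ℤ) + 1)))) * q.2)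

/-- The dilate `φ_i`, whose Fourier transform is `𝓕φ(2^{−i}ξ, 2^{−2i}τ)`. -/
def lpPhi {n : ℕ} (P : ParabolicLP n) (i : ℕ) : Rn1 n → ℂ :=
  fun x => (((2 : ℝ) ^ (i * (n + 2)) : ℝ) : ℂ) *
    P.φ (((2 : ℝ) ^ i) • x.1, ((2 : ℝ) ^ (2 * i)) * x.2)

/-- Parabolic Besov norm `N_{s,p}(f)` on `ℝ^{n+1}`, `1 ≤ p < ∞`. -/
def pBesov {n : ℕ} (P : ParabolicLP n) (s p : ℝ) (f : Rn1 n → ℂ) : ℝ≥0∞ :=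
  eLpNorm (conv1 (⇑P.ψ) f) (ENNReal.ofReal p) volume +
  (∑' i : ℕ,
    (ENNReal.ofReal ((2 : ℝ) ^ (s * ((i : ℝ) + 1))) *
      eLpNorm (conv1 (lpPhi P (i + 1)) f) (ENNReal.ofReal p) volume) ^ p) ^ (1 / p)

/-- Parabolic Besov norm `N_{s,∞}(f)` on `ℝ^{n+1}`. -/
def pBesovInf {n : ℕ} (P : ParabolicLP n) (s : ℝ) (f : Rn1 n → ℂ) : ℝ≥0∞ :=
  max (eLpNorm (conv1 (⇑P.ψ) f) ⊤ volume)
    (⨆ i : ℕ, ENNReal.ofReal ((2 : ℝ) ^ (s * ((i : ℝ) + 1))) *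
      eLpNorm (conv1 (lpPhi P (i + 1)) f) ⊤ volume)

/-- The time interval `(0, T)` for `0 < T ≤ ∞`. -/
def tSet (T : ℝ≥0∞) : Set ℝ := {t : ℝ | 0 < t ∧ ENNReal.ofReal t < T}

/-- Lebesgue measure restricted to the strip `ℝⁿ × (0,T)`. -/
def stripMeasure (n : ℕ) (T : ℝ≥0∞) : Measure (Rn1 n) :=
  volume.restrict {x : Rn1 n | x.2 ∈ tSet T}

/-- The parabolic Sobolev norm `‖g‖_{W^{2i,i}_p(ℝⁿ_T)}`. -/
def wNorm {n : ℕ} (i : ℕ) (p : ℝ) (T : ℝ≥0∞) (g : Rn1 n → ℂ) : ℝ≥0∞ :=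
  ∑ l ∈ Finset.range (i + 1),
    ∑ β ∈ (Fintype.piFinset fun _ : Fin n => Finset.range (2 * i + 1)).filter
        (fun β => (∑ k, β k) + 2 * l ≤ 2 * i),
      eLpNorm (dXmulti β (dT^[l] g)) (ENNReal.ofReal p) (stripMeasure n T)

/-- Time-regularity seminorm `[g]_{t,β,p,T}`. -/
def semT {n : ℕ} (b p : ℝ) (T : ℝ≥0∞) (g : Rn1 n → ℂ) : ℝ≥0∞ :=
  (∫⁻ X : Rn n, ∫⁻ t in tSet T, ∫⁻ s in tSet T,
      ENNReal.ofReal (‖g (X, t) - g (X, s)‖ ^ p / |t - s| ^ (1 + p * b / 2))) ^ (1 / p)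

/-- Space-regularity seminorm `[g]_{x,β,p,T}`. -/
def semX {n : ℕ} (b p : ℝ) (T : ℝ≥0∞) (g : Rn1 n → ℂ) : ℝ≥0∞ :=
  (∫⁻ t in tSet T, ∫⁻ X : Rn n, ∫⁻ Y : Rn n,
      ENNReal.ofReal (‖g (X + Y, t) - 2 * g (X, t) + g (X - Y, t)‖ ^ p /
        ‖Y‖ ^ ((n : ℝ) + p * b))) ^ (1 / p)

/-- The parabolic Besov norm `‖g‖_{B^{α,α/2}_p(ℝⁿ_T)}`, formed with index `i` where
`2i < α < 2i+2`. -/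
def pbNorm {n : ℕ} (i : ℕ) (α p : ℝ) (T : ℝ≥0∞) (g : Rn1 n → ℂ) : ℝ≥0∞ :=
  wNorm i p T g +
  ∑ l ∈ Finset.range (i + 1),
    ∑ β ∈ (Fintype.piFinset fun _ : Fin n => Finset.range (2 * i + 1)).filter
        (fun β => (∑ k, β k) + 2 * l = 2 * i),
      (semT (α - 2 * i) p T (dXmulti β (dT^[l] g)) +
        semX (α - 2 * i) p T (dXmulti β (dT^[l] g)))

/-- Fourier transform on `ℝⁿ`. -/
def FTn {n : ℕ} (f : Rn n → ℂ) (ξ : Rn n) : ℂ :=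
  ∫ x : Rn n, Complex.exp (-(2 * (π : ℂ) * Complex.I) * (((∑ k, x k * ξ k : ℝ)) : ℂ)) * f x

/-- Inverse Fourier transform on `ℝⁿ`. -/
def IFTn {n : ℕ} (f : Rn n → ℂ) (x : Rn n) : ℂ :=
  ∫ ξ : Rn n, Complex.exp ((2 * (π : ℂ) * Complex.I) * (((∑ k, ξ k * x k : ℝ)) : ℂ)) * f ξ

/-- Convolution on `ℝⁿ`. -/
def convn {n : ℕ} (g f : Rn n → ℂ) : Rn n → ℂ := fun x => ∫ y : Rn n, g (x - y) * f y

/-- A Littlewood–Paley family on `ℝⁿ`. -/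
structure LPFamily (n : ℕ) where
  φ : SchwartzMap (Rn n) ℂ
  ψ : SchwartzMap (Rn n) ℂ
  ft_pos : ∀ ξ : Rn n, 1 / 2 < ‖ξ‖ → ‖ξ‖ < 2 →
    0 < (FTn (⇑φ) ξ).re ∧ (FTn (⇑φ) ξ).im = 0
  ft_supp : ∀ ξ : Rn n, ¬(1 / 2 < ‖ξ‖ ∧ ‖ξ‖ < 2) → FTn (⇑φ) ξ = 0
  ft_sum : ∀ ξ : Rn n, ξ ≠ 0 → ∑' i : ℤ, FTn (⇑φ) (((2 : ℝ) ^ (-i)) • ξ) = 1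
  ft_psi : ∀ ξ : Rn n,
    FTn (⇑ψ) ξ = 1 - ∑' i : ℕ, FTn (⇑φ) (((2 : ℝ) ^ (-((i : ℤ) + 1))) • ξ)

/-- The dilate `φ′_i(x) = 2^{in} φ′(2^i x)`. -/
def lpPhin {n : ℕ} (P : LPFamily n) (i : ℕ) : Rn n → ℂ :=
  fun x => (((2 : ℝ) ^ (i * n) : ℝ) : ℂ) * P.φ (((2 : ℝ) ^ i) • x)

/-- Besov norm `B_{s,p}(f)` on `ℝⁿ`, `1 ≤ p < ∞`. -/
def besovN {n : ℕ} (P : LPFamily n) (s p : ℝ) (f : Rn n → ℂ) : ℝ≥0∞ :=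
  eLpNorm (convn (⇑P.ψ) f) (ENNReal.ofReal p) volume +
  (∑' i : ℕ,
    (ENNReal.ofReal ((2 : ℝ) ^ (s * ((i : ℝ) + 1))) *
      eLpNorm (convn (lpPhin P (i + 1)) f) (ENNReal.ofReal p) volume) ^ p) ^ (1 / p)

/-- The heat kernel `Γ(X,t)` on `ℝⁿ` (zero for `t ≤ 0`). -/
def heatKer (n : ℕ) (X : Rn n) (t : ℝ) : ℝ :=
  if 0 < t then (4 * π * t) ^ (-(n : ℝ) / 2) * Real.exp (-‖X‖ ^ 2 / (4 * t)) else 0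

/-- The heat extension `u(X,t) = ∫ Γ(X−Y,t) f(Y) dY`. -/
def heatExt {n : ℕ} (f : Rn n → ℂ) : Rn1 n → ℂ :=
  fun x => ∫ Y : Rn n, (heatKer n (x.1 - Y) x.2 : ℂ) * f Y

section

open scoped FourierTransform SchwartzMap

instance isAddHaarMeasure_volume_Rn1 {n : ℕ} : (volume : Measure (Rn1 n)).IsAddHaarMeasure :=
  Measure.prod.instIsAddHaarMeasure _ _

/-- Transport of Schwartz functions to the inner product space `WithLp 2 (ℝⁿ × ℝ)`. -/
def toL2 {n : ℕ} : 𝓢(Rn1 n, ℂ) →L[ℂ] 𝓢(WithLp 2 (Rn1 n), ℂ) :=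
  SchwartzMap.compCLMOfContinuousLinearEquiv ℂ (WithLp.prodContinuousLinearEquiv 2 ℝ (Rn n) ℝ)

/-- The inverse of `toL2`. -/
def ofL2 {n : ℕ} : 𝓢(WithLp 2 (Rn1 n), ℂ) →L[ℂ] 𝓢(Rn1 n, ℂ) :=
  SchwartzMap.compCLMOfContinuousLinearEquiv ℂ
    (WithLp.prodContinuousLinearEquiv 2 ℝ (Rn n) ℝ).symm

lemma toL2_apply {n : ℕ} (f : 𝓢(Rn1 n, ℂ)) (w : WithLp 2 (Rn1 n)) :
    toL2 f w = f (WithLp.ofLp w) := rfl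

lemma ofL2_apply {n : ℕ} (f : 𝓢(WithLp 2 (Rn1 n), ℂ)) (x : Rn1 n) :
    ofL2 f x = f (WithLp.toLp 2 x) := rfl

lemma ofL2_toL2 {n : ℕ} (f : 𝓢(Rn1 n, ℂ)) : ofL2 (toL2 f) = f := by
  ext x; rfl

lemma integral_comp_ofLp {n : ℕ} (g : Rn1 n → ℂ) :
    ∫ w : WithLp 2 (Rn1 n), g (WithLp.ofLp w) = ∫ x, g x :=
  (WithLp.volume_preserving_symm_measurableEquiv_toLp_prod (Rn n) ℝ).integral_comp
    (MeasurableEquiv.measurableEmbedding _) g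

lemma FT1_eq_fourier {n : ℕ} (f : 𝓢(Rn1 n, ℂ)) (q : Rn1 n) :
    FT1 (⇑f) q = 𝓕 (toL2 f) (WithLp.toLp 2 q) := by
  rw [SchwartzMap.fourier_coe, Real.fourier_eq', FT1]
  rw [← integral_comp_ofLp]
  refine integral_congr_ae (Filter.Eventually.of_forall fun w => ?_)
  simp only [toL2_apply, smul_eq_mul]
  congr 2
  simp only [WithLp.prod_inner_apply, PiLp.inner_apply, RCLike.inner_apply, conj_trivial]
  push_cast
  have : ∑ k, (w.ofLp.1 k : ℂ) * (q.1 k : ℂ) = ∑ k, (q.1 k : ℂ) * (w.ofLp.1 k : ℂ) :=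
    Finset.sum_congr rfl fun _ _ => mul_comm _ _
  rw [this]
  ring

/-- The Fourier transform as a Schwartz function. -/
def ftS {n : ℕ} (f : 𝓢(Rn1 n, ℂ)) : 𝓢(Rn1 n, ℂ) := ofL2 (𝓕 (toL2 f))

lemma ftS_apply {n : ℕ} (f : 𝓢(Rn1 n, ℂ)) (q : Rn1 n) : ftS f q = FT1 (⇑f) q := by
  rw [FT1_eq_fourier]; rfl

lemma exists_FT1_eq {n : ℕ} (a : 𝓢(Rn1 n, ℂ)) :
    ∃ A : 𝓢(Rn1 n, ℂ), ∀ q, FT1 (⇑A) q = a q := by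
  refine ⟨ofL2 (𝓕⁻ (toL2 a)), fun q => ?_⟩
  rw [FT1_eq_fourier]
  have : toL2 (ofL2 (𝓕⁻ (toL2 a))) = 𝓕⁻ (toL2 a) := by ext x; rfl
  rw [this, FourierTransform.fourier_fourierInv_eq]
  rfl

lemma FT1_injective {n : ℕ} {f g : 𝓢(Rn1 n, ℂ)} (h : ∀ q, FT1 (⇑f) q = FT1 (⇑g) q) : f = g := by
  have h' : 𝓕 (toL2 f) = 𝓕 (toL2 g) := by
    ext w
    have := h (WithLp.ofLp w)
    rwa [FT1_eq_fourier, FT1_eq_fourier] at this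
  have h2 : toL2 f = toL2 g := by
    have h3 := congrArg (fun u : 𝓢(WithLp 2 (Rn1 n), ℂ) => (𝓕⁻ u : 𝓢(WithLp 2 (Rn1 n), ℂ))) h'
    simpa only [FourierTransform.fourierInv_fourier_eq] using h3
  rw [← ofL2_toL2 f, h2, ofL2_toL2]

/-- Convolution of Schwartz functions, as a Schwartz function. -/
def convS {n : ℕ} (g f : 𝓢(Rn1 n, ℂ)) : 𝓢(Rn1 n, ℂ) :=
  ofL2 (SchwartzMap.convolution (ContinuousLinearMap.mul ℂ ℂ) (toL2 g) (toL2 f))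

lemma convS_apply {n : ℕ} (g f : 𝓢(Rn1 n, ℂ)) (x : Rn1 n) : convS g f x = conv1 (⇑g) (⇑f) x := by
  rw [convS, ofL2_apply, SchwartzMap.convolution_apply, MeasureTheory.convolution_eq_swap, conv1,
    ← integral_comp_ofLp]
  rfl

lemma coe_convS {n : ℕ} (g f : 𝓢(Rn1 n, ℂ)) : ⇑(convS g f) = conv1 (⇑g) (⇑f) :=
  funext (convS_apply g f)

lemma FT1_convS {n : ℕ} (g f : 𝓢(Rn1 n, ℂ)) (q : Rn1 n) :
    FT1 (⇑(convS g f)) q = FT1 (⇑g) q * FT1 (⇑f) q := by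
  simp only [FT1_eq_fourier]
  have : toL2 (convS g f) =
    SchwartzMap.convolution (ContinuousLinearMap.mul ℂ ℂ) (toL2 g) (toL2 f) := by ext x; rfl
  rw [this, SchwartzMap.fourier_convolution]
  rfl

/-- Translate of a Schwartz function. -/
def trS {n : ℕ} (v : Rn1 n) (f : 𝓢(Rn1 n, ℂ)) : 𝓢(Rn1 n, ℂ) :=
  SchwartzMap.compSubConstCLM ℂ (-v) f

lemma trS_apply {n : ℕ} (v : Rn1 n) (f : 𝓢(Rn1 n, ℂ)) (x : Rn1 n) : trS v f x = f (x + v) := by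
  simp [trS]

lemma FT1_trS {n : ℕ} (v : Rn1 n) (f : 𝓢(Rn1 n, ℂ)) (q : Rn1 n) :
    FT1 (⇑(trS v f)) q = Complex.exp ((2 * (π : ℂ) * Complex.I) *
      (((∑ k, v.1 k * q.1 k) + v.2 * q.2 : ℝ) : ℂ)) * FT1 (⇑f) q := by
  simp only [FT1, trS_apply]
  rw [← integral_const_mul, ← integral_sub_right_eq_self _ v]
  refine integral_congr_ae (Filter.Eventually.of_forall fun p => ?_)
  simp only [sub_add_cancel, ← mul_assoc, ← Complex.exp_add]
  congr 2
  simp only [Prod.fst_sub, Prod.snd_sub, PiLp.sub_apply, sub_mul, Finset.sum_sub_distrib]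
  push_cast
  ring

section

variable {n : ℕ}

lemma ftS_add (f g : 𝓢(Rn1 n, ℂ)) : ftS (f + g) = ftS f + ftS g := by
  simp only [ftS, map_add, FourierTransform.fourier_add]

/-- The Fourier transform as an additive map on Schwartz functions. -/
def ftHom : 𝓢(Rn1 n, ℂ) →+ 𝓢(Rn1 n, ℂ) := AddMonoidHom.mk' ftS ftS_add

lemma ftHom_apply (f : 𝓢(Rn1 n, ℂ)) (q : Rn1 n) : ftHom f q = FT1 (⇑f) q := ftS_apply f q

lemma FT1_add (f g : 𝓢(Rn1 n, ℂ)) (q : Rn1 n) :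
    FT1 (⇑(f + g)) q = FT1 (⇑f) q + FT1 (⇑g) q := by
  simp only [← ftHom_apply, map_add, add_apply]

lemma FT1_sub (f g : 𝓢(Rn1 n, ℂ)) (q : Rn1 n) :
    FT1 (⇑(f - g)) q = FT1 (⇑f) q - FT1 (⇑g) q := by
  simp only [← ftHom_apply, map_sub, sub_apply]

lemma FT1_sum {ι : Type*} (s : Finset ι) (f : ι → 𝓢(Rn1 n, ℂ)) (q : Rn1 n) :
    FT1 (⇑(∑ i ∈ s, f i)) q = ∑ i ∈ s, FT1 (⇑(f i)) q := by
  simp only [← ftHom_apply, map_sum, sum_apply]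

end

/-- The parabolic dilation `(X, t) ↦ (l X, l² t)`. -/
def dl {n : ℕ} (l : ℝ) (x : Rn1 n) : Rn1 n := (l • x.1, l ^ 2 * x.2)

lemma dl_sub {n : ℕ} (l : ℝ) (x y : Rn1 n) : dl l (x - y) = dl l x - dl l y := by
  ext <;> simp [dl, mul_sub]

lemma dl_add {n : ℕ} (l : ℝ) (x y : Rn1 n) : dl l (x + y) = dl l x + dl l y := by
  ext <;> simp [dl, mul_add]

lemma dl_dl {n : ℕ} (a b : ℝ) (x : Rn1 n) : dl a (dl b x) = dl (a * b) x := by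
  ext <;> simp [dl] <;> ring

lemma dl_one {n : ℕ} (x : Rn1 n) : dl 1 x = x := by
  ext <;> simp [dl]

/-- The parabolic dilation as a continuous linear equivalence. -/
def dlE {n : ℕ} (l : ℝ) (hl : 0 < l) : Rn1 n ≃L[ℝ] Rn1 n where
  toFun := dl l
  invFun := dl l⁻¹
  left_inv x := by rw [dl_dl, inv_mul_cancel₀ hl.ne', dl_one]
  right_inv x := by rw [dl_dl, mul_inv_cancel₀ hl.ne', dl_one]
  map_add' := dl_add l
  map_smul' c x := by ext <;> simp [dl] <;> ring
  continuous_toFun := by unfold dl; fun_prop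
  continuous_invFun := by unfold dl; fun_prop

/-- Precomposition of a Schwartz function with a parabolic dilation. -/
def dilS {n : ℕ} (l : ℝ) (hl : 0 < l) (f : 𝓢(Rn1 n, ℂ)) : 𝓢(Rn1 n, ℂ) :=
  SchwartzMap.compCLMOfContinuousLinearEquiv ℂ (dlE l hl) f

lemma dilS_apply {n : ℕ} (l : ℝ) (hl : 0 < l) (f : 𝓢(Rn1 n, ℂ)) (x : Rn1 n) :
    dilS l hl f x = f (dl l x) := rfl

/-- The `L¹`-normalized parabolic dilate of a Schwartz function. -/
def ndS {n : ℕ} (l : ℝ) (hl : 0 < l) (f : 𝓢(Rn1 n, ℂ)) : 𝓢(Rn1 n, ℂ) :=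
  ((l ^ (n + 2) : ℝ) : ℂ) • dilS l hl f

lemma ndS_apply {n : ℕ} (l : ℝ) (hl : 0 < l) (f : 𝓢(Rn1 n, ℂ)) (x : Rn1 n) :
    ndS l hl f x = ((l ^ (n + 2) : ℝ) : ℂ) * f (dl l x) := rfl

lemma map_dl_volume {n : ℕ} {l : ℝ} (hl : 0 < l) :
    Measure.map (dl l) (volume : Measure (Rn1 n)) =
      ENNReal.ofReal (l ^ (n + 2))⁻¹ • volume := by
  have h := Measure.map_prod_map (volume : Measure (Rn n)) (volume : Measure ℝ)
    (f := fun x => l • x) (g := fun t => l ^ 2 • t)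
    (measurable_const_smul l) (measurable_const_smul (l ^ 2))
  rw [Measure.map_addHaar_smul _ hl.ne', Measure.map_addHaar_smul _ (pow_pos hl 2).ne'] at h
  simp only [finrank_euclideanSpace, Fintype.card_fin, Module.finrank_self, pow_one] at h
  rw [Measure.prod_smul_left, Measure.prod_smul_right, smul_smul,
    abs_of_pos (by positivity), abs_of_pos (by positivity), ← ENNReal.ofReal_mul (by positivity)] at h
  have e : (l ^ n)⁻¹ * (l ^ 2)⁻¹ = (l ^ (n + 2))⁻¹ := by rw [pow_add, mul_inv]
  rw [e] at h
  exact h.symm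

lemma integral_comp_dl {n : ℕ} {l : ℝ} (hl : 0 < l) (g : Rn1 n → ℂ) :
    ((l ^ (n + 2) : ℝ) : ℂ) * ∫ x, g (dl l x) = ∫ x, g x := by
  have hemb : MeasurableEmbedding (dl l : Rn1 n → Rn1 n) :=
    ((dlE l hl : Rn1 n ≃L[ℝ] Rn1 n).toHomeomorph.measurableEmbedding)
  rw [← hemb.integral_map, map_dl_volume hl, integral_smul_measure,
    ENNReal.toReal_ofReal (by positivity), Complex.real_smul, ← mul_assoc, ← Complex.ofReal_mul,
    mul_inv_cancel₀ (by positivity)]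
  simp

lemma FT1_ndS {n : ℕ} (l : ℝ) (hl : 0 < l) (f : 𝓢(Rn1 n, ℂ)) (q : Rn1 n) :
    FT1 (⇑(ndS l hl f)) q = FT1 (⇑f) (dl l⁻¹ q) := by
  simp only [FT1]
  symm
  rw [← integral_comp_dl hl, ← integral_const_mul]
  refine integral_congr_ae (Filter.Eventually.of_forall fun p => ?_)
  simp only [ndS_apply]
  have e : (∑ k, (dl l p).1 k * (dl l⁻¹ q).1 k) + (dl l p).2 * (dl l⁻¹ q).2 =
      (∑ k, p.1 k * q.1 k) + p.2 * q.2 := by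
    simp only [dl, PiLp.smul_apply, smul_eq_mul]
    congr 1
    · refine Finset.sum_congr rfl fun k _ => ?_
      field_simp
    · field_simp
  rw [e]
  ring

lemma conv1_ndS {n : ℕ} (l : ℝ) (hl : 0 < l) (g f : 𝓢(Rn1 n, ℂ)) (x : Rn1 n) :
    conv1 (⇑(ndS l hl g)) (⇑f) x = conv1 (⇑g) (⇑(dilS l⁻¹ (inv_pos.2 hl) f)) (dl l x) := by
  simp only [conv1]
  symm
  rw [← integral_comp_dl hl, ← integral_const_mul]
  refine integral_congr_ae (Filter.Eventually.of_forall fun p => ?_)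
  simp only [ndS_apply, dilS_apply, dl_sub, dl_dl, inv_mul_cancel₀ hl.ne', dl_one]
  ring

/-- The parabolic size `|ξ| + |τ|^{1/2}`. -/
def rho {n : ℕ} (q : Rn1 n) : ℝ := ‖q.1‖ + |q.2| ^ ((1 : ℝ) / 2)

lemma rho_dl {n : ℕ} {l : ℝ} (hl : 0 < l) (q : Rn1 n) : rho (dl l q) = l * rho q := by
  simp only [rho, dl, norm_smul, abs_mul, Real.norm_eq_abs, abs_of_pos hl]
  rw [Real.mul_rpow (by positivity) (by positivity), abs_of_pos (pow_pos hl 2),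
    ← Real.sqrt_eq_rpow, Real.sqrt_sq hl.le]
  ring

lemma dl_two_zpow {n : ℕ} (i : ℤ) (q : Rn1 n) :
    dl ((2 : ℝ) ^ (-i)) q = (((2 : ℝ) ^ (-i)) • q.1, ((2 : ℝ) ^ (-(2 * i))) * q.2) := by
  simp only [dl]
  rw [← zpow_natCast, ← zpow_mul]
  congr 3
  push_cast
  ring

section

variable {n : ℕ} (P : ParabolicLP n)

lemma FT1_phi_eq_zero {q : Rn1 n} (h : ¬(1 / 2 < rho q ∧ rho q < 2)) : FT1 (⇑P.φ) q = 0 :=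
  P.ft_supp q h

lemma FT1_psi_eq (q : Rn1 n) :
    FT1 (⇑P.ψ) q = 1 - ∑' i : ℕ, FT1 (⇑P.φ) (dl ((2 : ℝ) ^ (-((i : ℤ) + 1))) q) := by
  rw [P.ft_psi]
  simp only [dl_two_zpow]

lemma tsum_FT1_phi {q : Rn1 n} (h : q ≠ 0) :
    ∑' i : ℤ, FT1 (⇑P.φ) (dl ((2 : ℝ) ^ (-i)) q) = 1 := by
  rw [← P.ft_sum q h]
  simp only [dl_two_zpow]

lemma summable_FT1_phi (q : Rn1 n) :
    Summable fun i : ℕ => FT1 (⇑P.φ) (dl ((2 : ℝ) ^ (-(i : ℤ))) q) := by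
  have ht : Filter.Tendsto (fun i : ℕ => ((1 / 2 : ℝ)) ^ i * rho q) Filter.atTop (nhds 0) := by
    simpa using (tendsto_pow_atTop_nhds_zero_of_lt_one (r := (1 / 2 : ℝ))
      (by norm_num) (by norm_num)).mul_const (rho q)
  obtain ⟨N, hN⟩ := Filter.eventually_atTop.1
    (ht.eventually (gt_mem_nhds (by norm_num : (0 : ℝ) < 1 / 2)))
  refine summable_of_ne_finset_zero (s := Finset.range N) fun i hi => FT1_phi_eq_zero P ?_
  rw [rho_dl (by positivity)]
  have := hN i (by simpa using hi)
  rw [one_div, inv_pow] at this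
  rw [zpow_neg, zpow_natCast]
  intro h
  linarith [h.1]

lemma FT1_psi_zero : FT1 (⇑P.ψ) 0 = 1 := by
  rw [FT1_psi_eq]
  have : ∀ l : ℝ, FT1 (⇑P.φ) (dl l 0) = 0 := fun l => FT1_phi_eq_zero P (by
    have : rho (dl l (0 : Rn1 n)) = 0 := by simp [rho, dl]
    rw [this]; norm_num)
  simp [this]

lemma FT1_psi_eq_zero {q : Rn1 n} (h : 2 ≤ rho q) : FT1 (⇑P.ψ) q = 0 := by
  have hq : q ≠ 0 := by
    rintro rfl
    have : rho (0 : Rn1 n) = 0 := by simp [rho]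
    linarith
  rw [FT1_psi_eq, ← tsum_FT1_phi P hq, sub_eq_zero]
  have hinj : Function.Injective (fun i : ℕ => (i : ℤ) + 1) := fun a b hab => by
    simpa using hab
  symm
  refine hinj.tsum_eq (f := fun i : ℤ => FT1 (⇑P.φ) (dl ((2 : ℝ) ^ (-i)) q)) ?_
  intro i hi
  by_contra hni
  apply hi
  refine FT1_phi_eq_zero P ?_
  rw [rho_dl (by positivity)]
  have hi0 : i ≤ 0 := by
    by_contra hpos
    exact hni ⟨(i - 1).toNat, by
      simp only
      omega⟩
  have h1 : (1 : ℝ) ≤ 2 ^ (-i) := one_le_zpow₀ (by norm_num) (by omega)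
  intro hh
  nlinarith [hh.2]

lemma FT1_psi_sub (q : Rn1 n) :
    FT1 (⇑P.ψ) q = FT1 (⇑P.ψ) (dl 2 q) + FT1 (⇑P.φ) q := by
  have hs := (summable_FT1_phi P q).tsum_eq_zero_add
  rw [FT1_psi_eq, FT1_psi_eq]
  have e : ∀ i : ℕ, dl ((2 : ℝ) ^ (-((i : ℤ) + 1))) (dl 2 q) = dl ((2 : ℝ) ^ (-(i : ℤ))) q := by
    intro i
    rw [dl_dl]
    congr 1
    rw [neg_add, zpow_add₀ (by norm_num)]
    simp
  simp only [e]
  rw [hs]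
  push_cast
  simp only [zpow_zero, neg_zero, dl_one]
  ring

/-- The dilates `φ_i` as Schwartz functions. -/
def phS (i : ℕ) : 𝓢(Rn1 n, ℂ) := ndS ((2 : ℝ) ^ i) (by positivity) P.φ

/-- The dilates of `ψ` as Schwartz functions. -/
def psS (i : ℕ) : 𝓢(Rn1 n, ℂ) := ndS ((2 : ℝ) ^ i) (by positivity) P.ψ

lemma coe_phS (i : ℕ) : ⇑(phS P i) = lpPhi P i := by
  funext x
  simp only [phS, ndS_apply, lpPhi, dl, ← pow_mul, mul_comm 2 i]

lemma psS_zero : psS P 0 = P.ψ := by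
  ext x
  simp [psS, ndS_apply, dl_one]

lemma psS_succ (i : ℕ) : psS P (i + 1) = psS P i + phS P (i + 1) := by
  refine FT1_injective fun q => ?_
  rw [FT1_add]
  simp only [psS, phS, FT1_ndS]
  rw [FT1_psi_sub, dl_dl]
  congr 3
  rw [pow_succ]
  field_simp

end

section

variable {n : ℕ}

/-- First difference of a Schwartz function. -/
def diff1 (v : Rn1 n) (f : 𝓢(Rn1 n, ℂ)) : 𝓢(Rn1 n, ℂ) := trS v f - f

/-- Negative symmetric second difference of a Schwartz function. -/
def diff2 (v : Rn1 n) (f : 𝓢(Rn1 n, ℂ)) : 𝓢(Rn1 n, ℂ) := f + f - (trS v f + trS (-v) f)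

lemma diff1_apply (v : Rn1 n) (f : 𝓢(Rn1 n, ℂ)) (x : Rn1 n) :
    diff1 v f x = f (x + v) - f x := by
  simp [diff1, trS_apply]

lemma diff2_apply (v : Rn1 n) (f : 𝓢(Rn1 n, ℂ)) (x : Rn1 n) :
    diff2 v f x = 2 * f x - (f (x + v) + f (x - v)) := by
  simp [diff2, trS_apply, two_mul, sub_eq_add_neg]

/-- The Euclidean pairing on `ℝⁿ × ℝ`. -/
def pair1 (v q : Rn1 n) : ℝ := (∑ k, v.1 k * q.1 k) + v.2 * q.2

lemma pair1_neg (v q : Rn1 n) : pair1 (-v) q = -pair1 v q := by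
  simp [pair1, Finset.sum_neg_distrib]
  ring

lemma FT1_diff2 (v : Rn1 n) (f : 𝓢(Rn1 n, ℂ)) (q : Rn1 n) :
    FT1 (⇑(diff2 v f)) q = ((2 - 2 * Real.cos (2 * π * pair1 v q) : ℝ) : ℂ) * FT1 (⇑f) q := by
  rw [diff2, FT1_sub, FT1_add, FT1_add, FT1_trS, FT1_trS]
  have h := pair1_neg v q
  have h2 := Complex.two_cos (x := ((2 * π * pair1 v q : ℝ) : ℂ))
  simp only [pair1] at h h2 ⊢
  rw [h]
  push_cast at h2 ⊢
  rw [h2]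
  ring_nf

lemma convS_diff2 (v : Rn1 n) (K f : 𝓢(Rn1 n, ℂ)) :
    diff2 v (convS K f) = convS (diff2 v K) f :=
  FT1_injective fun q => by simp only [FT1_convS, FT1_diff2, mul_assoc]

lemma convS_diff1 (v : Rn1 n) (K f : 𝓢(Rn1 n, ℂ)) :
    diff1 v (convS K f) = convS (diff1 v K) f :=
  FT1_injective fun q => by simp only [diff1, FT1_convS, FT1_sub, FT1_trS]; ring

lemma norm_convS_le (g f : 𝓢(Rn1 n, ℂ)) {M : ℝ} (hf : ∀ x, ‖f x‖ ≤ M) (x : Rn1 n) :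
    ‖convS g f x‖ ≤ (∫ y, ‖g y‖) * M := by
  rw [convS_apply, conv1]
  have hg : Integrable (fun y => ‖g y‖) (volume : Measure (Rn1 n)) := g.integrable.norm
  calc ‖∫ y, g (x - y) * f y‖ ≤ ∫ y, ‖g (x - y)‖ * M := by
        refine norm_integral_le_of_norm_le ((hg.comp_sub_left x).mul_const M)
          (Filter.Eventually.of_forall fun y => ?_)
        rw [norm_mul]
        exact mul_le_mul_of_nonneg_left (hf y) (norm_nonneg _)
    _ = (∫ y, ‖g y‖) * M := by
        rw [integral_mul_const, integral_sub_left_eq_self (fun y => ‖g y‖) volume x]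

lemma norm_le_of_rho_lt {q : Rn1 n} (h : rho q < 2) : ‖q‖ ≤ 4 := by
  have h1 : 0 ≤ ‖q.1‖ := norm_nonneg _
  have h2 : 0 ≤ |q.2| ^ ((1 : ℝ) / 2) := by positivity
  have h3 : (|q.2| ^ ((1 : ℝ) / 2)) ^ 2 = |q.2| := by
    rw [← Real.sqrt_eq_rpow, Real.sq_sqrt (abs_nonneg _)]
  unfold rho at h
  rw [Prod.norm_def, max_le_iff, Real.norm_eq_abs]
  constructor <;> nlinarith

lemma continuous_rho : Continuous (rho : Rn1 n → ℝ) := by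
  unfold rho
  have : Continuous fun q : Rn1 n => |q.2| ^ ((1 : ℝ) / 2) :=
    (continuous_snd.abs).rpow_const fun _ => Or.inr (by norm_num)
  exact continuous_fst.norm.add this

/-- A Schwartz kernel reproducing all functions with spectrum in `{rho < 2}`. -/
lemma exists_reproducing_kernel (n : ℕ) : ∃ K : 𝓢(Rn1 n, ℂ), ∀ g f : 𝓢(Rn1 n, ℂ),
    (∀ q, 2 ≤ rho q → FT1 (⇑g) q = 0) → convS K (convS g f) = convS g f := by
  let b : ContDiffBump (0 : Rn1 n) := ⟨4, 5, by norm_num, by norm_num⟩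
  have hc : HasCompactSupport fun x => ((b x : ℝ) : ℂ) :=
    b.hasCompactSupport.comp_left (g := fun r : ℝ => (r : ℂ)) (by simp)
  have hs : ContDiff ℝ (⊤ : ℕ∞) fun x => ((b x : ℝ) : ℂ) :=
    Complex.ofRealCLM.contDiff.comp b.contDiff
  obtain ⟨K, hK⟩ := exists_FT1_eq (hc.toSchwartzMap hs)
  refine ⟨K, fun g f hg => FT1_injective fun q => ?_⟩
  rw [FT1_convS, FT1_convS, hK]
  rcases le_or_gt 2 (rho q) with h | h
  · simp [hg q h]
  · have : b q = 1 := b.one_of_mem_closedBall (by simpa using norm_le_of_rho_lt h)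
    simp [this]

/-- The sampling vectors: `e_k / 4` in space, and `1 / 8` in time. -/
def vX (k : Fin n) : Rn1 n := (EuclideanSpace.single k (1 / 4), 0)

/-- The time sampling vector. -/
def vT : Rn1 n := (0, 1 / 8)

lemma pair1_vX (k : Fin n) (q : Rn1 n) : pair1 (vX k) q = q.1 k / 4 := by
  simp [pair1, vX]
  ring

lemma pair1_vT (q : Rn1 n) : pair1 vT q = q.2 / 8 := by
  simp [pair1, vT]
  ring

/-- The total symbol of the sampled second differences. -/
def mS (q : Rn1 n) : ℝ :=
  (∑ k, (2 - 2 * Real.cos (2 * π * pair1 (vX k) q))) + (2 - 2 * Real.cos (2 * π * pair1 vT q))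

lemma contDiff_mS : ContDiff ℝ (⊤ : ℕ∞) (mS : Rn1 n → ℝ) := by
  unfold mS
  simp only [pair1_vX, pair1_vT]
  fun_prop

lemma mS_ne_zero {q : Rn1 n} (h0 : 0 < rho q) (h2 : rho q ≤ 2) : mS q ≠ 0 := by
  intro hm
  have hc : ∀ x : ℝ, 0 ≤ 2 - 2 * Real.cos x := fun x => by linarith [Real.cos_le_one x]
  unfold mS at hm
  rw [add_eq_zero_iff_of_nonneg (Finset.sum_nonneg fun k _ => hc _) (hc _),
    Finset.sum_eq_zero_iff_of_nonneg fun k _ => hc _] at hm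
  obtain ⟨hX, hT⟩ := hm
  have h1 : 0 ≤ ‖q.1‖ := norm_nonneg _
  have h3 : 0 ≤ |q.2| ^ ((1 : ℝ) / 2) := by positivity
  have h4 : (|q.2| ^ ((1 : ℝ) / 2)) ^ 2 = |q.2| := by
    rw [← Real.sqrt_eq_rpow, Real.sq_sqrt (abs_nonneg _)]
  have h2' := h2
  unfold rho at h2'
  have key : ∀ y : ℝ, |y| ≤ 1 / 2 → 2 - 2 * Real.cos (2 * π * y) = 0 → y = 0 := by
    intro y hy h
    have hπ := Real.pi_pos
    rw [abs_le] at hy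
    have := (Real.cos_eq_one_iff_of_lt_of_lt (x := 2 * π * y) (by nlinarith) (by nlinarith)).1
      (by linarith)
    have h2π : 2 * π ≠ 0 := by positivity
    exact (mul_eq_zero.1 this).resolve_left h2π
  have hq2 : q.2 = 0 := by
    rw [pair1_vT] at hT
    have := key (q.2 / 8) (by rw [abs_div, abs_of_pos (by norm_num : (0 : ℝ) < 8)]; nlinarith) hT
    linarith
  have hq1 : q.1 = 0 := by
    ext k
    have hk := hX k (Finset.mem_univ k)
    rw [pair1_vX] at hk
    have hle : |q.1 k| ≤ ‖q.1‖ := by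
      simpa using PiLp.norm_apply_le q.1 k
    have := key (q.1 k / 4)
      (by rw [abs_div, abs_of_pos (by norm_num : (0 : ℝ) < 4)]; linarith) hk
    simp only [PiLp.zero_apply]
    linarith
  rw [rho, hq1, hq2] at h0
  simp at h0

/-- Convolution with `φ` factors through second differences. -/
lemma exists_phi_factor (P : ParabolicLP n) : ∃ A : 𝓢(Rn1 n, ℂ), ∀ f : 𝓢(Rn1 n, ℂ),
    convS P.φ f = ∑ k, convS A (diff2 (vX k) f) + convS A (diff2 vT f) := by
  let a : Rn1 n → ℂ := fun q => FT1 (⇑P.φ) q / (mS q : ℂ)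
  have hphi : ContDiff ℝ (⊤ : ℕ∞) (FT1 (⇑P.φ)) := by
    have : FT1 (⇑P.φ) = ⇑(ftS P.φ) := funext fun q => (ftS_apply _ _).symm
    rw [this]
    exact (ftS P.φ).smooth ⊤
  have hc : HasCompactSupport a := by
    refine HasCompactSupport.intro (isCompact_closedBall (0 : Rn1 n) 4) fun q hq => ?_
    have : FT1 (⇑P.φ) q = 0 := FT1_phi_eq_zero P fun h =>
      hq (by simpa using norm_le_of_rho_lt h.2)
    simp [a, this]
  have hs : ContDiff ℝ (⊤ : ℕ∞) a := by
    rw [contDiff_iff_contDiffAt]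
    intro q
    by_cases hm : mS q = 0
    · have hopen : IsOpen {p : Rn1 n | rho p < 1 / 2 ∨ 2 < rho p} :=
        (isOpen_lt continuous_rho continuous_const).union
          (isOpen_lt continuous_const continuous_rho)
      have hq : q ∈ {p : Rn1 n | rho p < 1 / 2 ∨ 2 < rho p} := by
        by_contra hcon
        simp only [Set.mem_ofPred_eq, not_or, not_lt] at hcon
        exact mS_ne_zero (by linarith [hcon.1]) hcon.2 hm
      refine (contDiffAt_const (c := (0 : ℂ))).congr_of_eventuallyEq ?_
      filter_upwards [hopen.mem_nhds hq] with p hp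
      have : FT1 (⇑P.φ) p = 0 := FT1_phi_eq_zero P fun h => by
        rcases hp with hp | hp
        · linarith [h.1]
        · linarith [h.2]
      simp [a, this]
    · have hmS : ContDiff ℝ (⊤ : ℕ∞) fun q : Rn1 n => (mS q : ℂ) :=
        Complex.ofRealCLM.contDiff.comp contDiff_mS
      simp only [a, div_eq_mul_inv]
      exact hphi.contDiffAt.mul (hmS.contDiffAt.inv (by exact_mod_cast hm))
  obtain ⟨A, hA⟩ := exists_FT1_eq (hc.toSchwartzMap hs)
  refine ⟨A, fun f => FT1_injective fun q => ?_⟩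
  simp only [FT1_add, FT1_sum, FT1_convS, FT1_diff2, hA]
  have hdec : FT1 (⇑P.φ) q = a q * (mS q : ℂ) := by
    by_cases hm : mS q = 0
    · have : FT1 (⇑P.φ) q = 0 := FT1_phi_eq_zero P fun h =>
        mS_ne_zero (by linarith [h.1]) h.2.le hm
      simp [a, this]
    · have hm' : (mS q : ℂ) ≠ 0 := by exact_mod_cast hm
      simp only [a]
      field_simp
  rw [hdec, HasCompactSupport.toSchwartzMap_toFun]
  simp only [mS, Complex.ofReal_add, Complex.ofReal_sum]
  rw [← Finset.mul_sum, ← Finset.sum_mul]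
  ring

end

section

variable {n : ℕ} {V : Type*} [NormedAddCommGroup V] [NormedSpace ℝ V]

/-- A weighted derivative bound gives a weighted bound on increments. -/
lemma weighted_increment_le (N : ℕ) {G : Rn1 n → V} (hG : Differentiable ℝ G) {M : ℝ}
    (hM : ∀ w, (1 + ‖w‖) ^ N * ‖fderiv ℝ G w‖ ≤ M) (z h : Rn1 n) (hh : ‖h‖ ≤ 1) :
    (1 + ‖z‖) ^ N * ‖G (z + h) - G z‖ ≤ 2 ^ N * M * ‖h‖ := by
  have hz : (0 : ℝ) < (1 + ‖z‖) ^ N := by positivity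
  have hb : ∀ w ∈ Metric.closedBall z ‖h‖, ‖fderiv ℝ G w‖ ≤ 2 ^ N * M / (1 + ‖z‖) ^ N := by
    intro w hw
    rw [le_div_iff₀ hz]
    have h1 : 1 + ‖z‖ ≤ 2 * (1 + ‖w‖) := by
      have h2 : ‖z‖ ≤ ‖w‖ + ‖w - z‖ := by
        have := norm_sub_le w (w - z)
        simpa using this
      have h3 : ‖w - z‖ ≤ ‖h‖ := by simpa [dist_eq_norm] using hw
      linarith [norm_nonneg w]
    calc ‖fderiv ℝ G w‖ * (1 + ‖z‖) ^ N ≤ ‖fderiv ℝ G w‖ * (2 * (1 + ‖w‖)) ^ N := by gcongr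
      _ = 2 ^ N * ((1 + ‖w‖) ^ N * ‖fderiv ℝ G w‖) := by rw [mul_pow]; ring
      _ ≤ 2 ^ N * M := by gcongr; exact hM w
  have := (convex_closedBall z ‖h‖).norm_image_sub_le_of_norm_fderiv_le (𝕜 := ℝ)
    (fun w _ => hG w) hb (Metric.mem_closedBall_self (norm_nonneg h))
    (y := z + h) (by simp)
  rw [add_sub_cancel_left] at this
  calc (1 + ‖z‖) ^ N * ‖G (z + h) - G z‖
      ≤ (1 + ‖z‖) ^ N * (2 ^ N * M / (1 + ‖z‖) ^ N * ‖h‖) := by gcongr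
    _ = 2 ^ N * M * ‖h‖ := by field_simp

lemma exists_weighted_bound (N : ℕ) (F : 𝓢(Rn1 n, V)) :
    ∃ M : ℝ, 0 ≤ M ∧ ∀ w, (1 + ‖w‖) ^ N * ‖F w‖ ≤ M := by
  refine ⟨2 ^ N * (Finset.Iic (N, 0)).sup (fun m => SchwartzMap.seminorm ℝ m.1 m.2) F,
    by positivity, fun w => ?_⟩
  have := SchwartzMap.one_add_le_sup_seminorm_apply (𝕜 := ℝ) (m := (N, 0)) le_rfl le_rfl F w
  simpa using this

lemma exists_weighted_diff (N : ℕ) (F : 𝓢(Rn1 n, V)) :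
    ∃ M : ℝ, 0 ≤ M ∧ ∀ z h : Rn1 n, ‖h‖ ≤ 1 →
      (1 + ‖z‖) ^ N * ‖F (z + h) - F z‖ ≤ M * ‖h‖ := by
  obtain ⟨M, hM0, hM⟩ := exists_weighted_bound N (SchwartzMap.fderivCLM ℝ _ _ F)
  exact ⟨2 ^ N * M, by positivity, fun z h hh =>
    weighted_increment_le N F.differentiable hM z h hh⟩

lemma exists_weighted_diff2 (N : ℕ) (F : 𝓢(Rn1 n, V)) :
    ∃ M : ℝ, 0 ≤ M ∧ ∀ z h : Rn1 n, ‖h‖ ≤ 1 →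
      (1 + ‖z‖) ^ N * ‖F z + F z - (F (z + h) + F (z - h))‖ ≤ M * ‖h‖ ^ 2 := by
  obtain ⟨M, hM0, hM⟩ := exists_weighted_diff N (SchwartzMap.fderivCLM ℝ _ _ F)
  refine ⟨2 ^ N * M, by positivity, fun z h hh => ?_⟩
  have hd : Differentiable ℝ fun w => F (w + h) :=
    F.differentiable.comp (differentiable_id.add_const h)
  have hfd : ∀ w, fderiv ℝ (fun w => F (w + h) - F w) w = fderiv ℝ F (w + h) - fderiv ℝ F w := by
    intro w
    rw [fderiv_fun_sub (hd w) (F.differentiable w), fderiv_comp_add_right]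
  have := weighted_increment_le N (G := fun w => F (w + h) - F w) (hd.sub F.differentiable)
    (M := M * ‖h‖) (fun w => by rw [hfd]; exact hM w h hh) z (-h) (by simpa using hh)
  simp only [neg_add_cancel_right, norm_neg] at this
  calc _ = (1 + ‖z‖) ^ N * ‖F z - F (z + -h) - (F (z + h) - F z)‖ := by
        congr 2
        rw [sub_eq_add_neg z h]
        abel
    _ ≤ _ := this
    _ = _ := by ring

end

section

variable {n : ℕ}

lemma exists_L1_bound (n : ℕ) : ∃ J : ℝ, 0 ≤ J ∧ ∀ (F : 𝓢(Rn1 n, ℂ)) (M : ℝ),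
    (∀ z, (1 + ‖z‖) ^ (n + 2) * ‖F z‖ ≤ M) → ∫ z, ‖F z‖ ≤ M * J := by
  refine ⟨∫ z : Rn1 n, ((1 + ‖z‖) ^ (n + 2))⁻¹, integral_nonneg fun z => by positivity,
    fun F M hM => ?_⟩
  rw [← integral_const_mul]
  refine integral_mono F.integrable.norm ?_ fun z => ?_
  · have := integrable_one_add_norm (E := Rn1 n) (μ := volume) (r := ((n + 2 : ℕ) : ℝ))
      (by simp [Module.finrank_prod])
    refine (this.congr (Filter.Eventually.of_forall fun z => ?_)).const_mul M
    simp only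
    rw [Real.rpow_neg (by positivity), Real.rpow_natCast]
  · simp only
    rw [← div_eq_mul_inv, le_div_iff₀ (by positivity), mul_comm]
    exact hM z

/-- Bernstein-type bounds for functions reproduced by a Schwartz kernel. -/
lemma exists_bernstein (K : 𝓢(Rn1 n, ℂ)) : ∃ C : ℝ, 4 ≤ C ∧ ∀ (u : 𝓢(Rn1 n, ℂ)),
    convS K u = u → ∀ M : ℝ, (∀ x, ‖u x‖ ≤ M) → ∀ h x : Rn1 n,
      ‖diff1 h u x‖ ≤ C * min 1 ‖h‖ * M ∧ ‖diff2 h u x‖ ≤ C * min 1 (‖h‖ ^ 2) * M := by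
  obtain ⟨J, hJ0, hJ⟩ := exists_L1_bound n
  obtain ⟨M1, hM10, hM1⟩ := exists_weighted_diff (n + 2) K
  obtain ⟨M2, hM20, hM2⟩ := exists_weighted_diff2 (n + 2) K
  have p1 : 0 ≤ M1 * J := by positivity
  have p2 : 0 ≤ M2 * J := by positivity
  refine ⟨4 + M1 * J + M2 * J, by linarith, fun u hu M hM h x => ?_⟩
  have hM0 : 0 ≤ M := (norm_nonneg _).trans (hM 0)
  rcases le_or_gt ‖h‖ 1 with hh | hh
  · have hh2 : ‖h‖ ^ 2 ≤ 1 := pow_le_one₀ (norm_nonneg _) hh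
    rw [min_eq_right hh, min_eq_right hh2]
    constructor
    · rw [← hu, convS_diff1]
      refine (norm_convS_le _ _ hM x).trans (mul_le_mul_of_nonneg_right ?_ hM0)
      refine (hJ _ (M1 * ‖h‖) fun z => by rw [diff1_apply]; exact hM1 z h hh).trans ?_
      nlinarith [norm_nonneg h]
    · rw [← hu, convS_diff2]
      refine (norm_convS_le _ _ hM x).trans (mul_le_mul_of_nonneg_right ?_ hM0)
      refine (hJ _ (M2 * ‖h‖ ^ 2) fun z => by
        rw [diff2_apply, two_mul]; exact hM2 z h hh).trans ?_
      nlinarith [sq_nonneg ‖h‖]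
  · have hh2 : 1 ≤ ‖h‖ ^ 2 := one_le_pow₀ hh.le
    rw [min_eq_left hh.le, min_eq_left hh2]
    have e : 4 * M ≤ (4 + M1 * J + M2 * J) * 1 * M := by nlinarith
    constructor
    · rw [diff1_apply]
      refine (norm_sub_le _ _).trans ?_
      linarith [hM (x + h), hM x]
    · rw [diff2_apply]
      refine (norm_sub_le _ _).trans ?_
      have := norm_add_le (u (x + h)) (u (x - h))
      rw [norm_mul, Complex.norm_ofNat]
      linarith [hM (x + h), hM x, hM (x - h)]

end

section

/-- Dyadic sums of `x^{-α} min(1, x²)` are uniformly bounded for `0 < α < 2`. -/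
lemma exists_dyadic_sum_bound {α : ℝ} (hα0 : 0 < α) (hα2 : α < 2) :
    ∃ S : ℝ, 0 < S ∧ ∀ r : ℝ, 0 ≤ r → ∀ N : ℕ,
      ∑ i ∈ Finset.range N, ((2 : ℝ) ^ i) ^ (-α) * min 1 (((2 : ℝ) ^ i * r) ^ 2) ≤ S * r ^ α := by
  set γ := min α (2 - α) with hγ
  have hγ0 : 0 < γ := lt_min hα0 (by linarith)
  set b := (2 : ℝ) ^ γ with hb
  have hb1 : 1 < b := Real.one_lt_rpow (by norm_num) hγ0
  have hS : 0 < 4 * b / (b - 1) := div_pos (by linarith) (by linarith)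
  let Φ : ℝ → ℝ := fun x => x ^ γ / (1 + x ^ γ)
  have hΦ : ∀ x : ℝ, 0 < x →
      x ^ (-α) * min 1 (x ^ 2) ≤ 4 * b / (b - 1) * (Φ (2 * x) - Φ x) := by
    intro x hx
    have hy : 0 < x ^ γ := Real.rpow_pos_of_pos hx γ
    simp only [Φ]
    rw [Real.mul_rpow (by norm_num) hx.le, ← hb]
    set y := x ^ γ with hydef
    have hby : 0 < b * y := by positivity
    have e : 4 * b / (b - 1) * (b * y / (1 + b * y) - y / (1 + y)) =
        4 * b * y / ((1 + b * y) * (1 + y)) := by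
      have : b - 1 ≠ 0 := by linarith
      field_simp
      ring
    rw [e]
    rcases le_total x 1 with h1 | h1
    · have hy1 : y ≤ 1 := Real.rpow_le_one hx.le h1 hγ0.le
      have h2 : x ^ (-α) * min 1 (x ^ 2) ≤ y := by
        calc x ^ (-α) * min 1 (x ^ 2) ≤ x ^ (-α) * x ^ (2 : ℝ) := by
              rw [Real.rpow_two]
              gcongr
              exact min_le_right _ _
          _ = x ^ (2 - α) := by rw [← Real.rpow_add hx]; congr 1; ring
          _ ≤ x ^ γ := Real.rpow_le_rpow_of_exponent_ge hx h1 (min_le_right _ _)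
      refine h2.trans ?_
      rw [le_div_iff₀ (by positivity)]
      have : (1 + b * y) * (1 + y) ≤ (2 * b) * 2 := by
        apply mul_le_mul <;> nlinarith
      nlinarith
    · have hy1 : 1 ≤ y := Real.one_le_rpow h1 hγ0.le
      have h2 : x ^ (-α) * min 1 (x ^ 2) ≤ y⁻¹ := by
        calc x ^ (-α) * min 1 (x ^ 2) ≤ x ^ (-α) * 1 := by
              gcongr
              exact min_le_left _ _
          _ ≤ x ^ (-γ) := by
              rw [mul_one]
              exact Real.rpow_le_rpow_of_exponent_le h1 (neg_le_neg (min_le_left _ _))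
          _ = y⁻¹ := Real.rpow_neg hx.le γ
      refine h2.trans ?_
      rw [le_div_iff₀ (by positivity), inv_mul_le_iff₀ hy]
      have : (1 + b * y) * (1 + y) ≤ (2 * (b * y)) * (2 * y) := by
        apply mul_le_mul <;> nlinarith
      nlinarith
  refine ⟨4 * b / (b - 1), hS, fun r hr N => ?_⟩
  rcases hr.eq_or_lt with rfl | hr
  · simp [Real.zero_rpow hα0.ne']
  have hterm : ∀ i : ℕ, ((2 : ℝ) ^ i) ^ (-α) * min 1 (((2 : ℝ) ^ i * r) ^ 2) ≤
      4 * b / (b - 1) * r ^ α * (Φ ((2 : ℝ) ^ (i + 1) * r) - Φ ((2 : ℝ) ^ i * r)) := by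
    intro i
    have h := hΦ ((2 : ℝ) ^ i * r) (by positivity)
    rw [Real.mul_rpow (by positivity) hr.le] at h
    have hrα : 0 < r ^ α := Real.rpow_pos_of_pos hr α
    have e : r ^ (-α) * r ^ α = 1 := by rw [← Real.rpow_add hr]; simp
    calc ((2 : ℝ) ^ i) ^ (-α) * min 1 (((2 : ℝ) ^ i * r) ^ 2)
        = (((2 : ℝ) ^ i) ^ (-α) * r ^ (-α) * min 1 (((2 : ℝ) ^ i * r) ^ 2)) * r ^ α := by
          linear_combination -(((2 : ℝ) ^ i) ^ (-α) * min 1 (((2 : ℝ) ^ i * r) ^ 2)) * e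
      _ ≤ _ := mul_le_mul_of_nonneg_right h hrα.le
      _ = _ := by rw [← mul_assoc 2, ← pow_succ']; ring
  have hΦ1 : ∀ x : ℝ, 0 < x → 0 ≤ Φ x ∧ Φ x ≤ 1 := by
    intro x hx
    have hy : 0 < x ^ γ := Real.rpow_pos_of_pos hx γ
    exact ⟨by positivity, (div_le_one (by positivity)).2 (by linarith)⟩
  calc _ ≤ ∑ i ∈ Finset.range N, 4 * b / (b - 1) * r ^ α *
        (Φ ((2 : ℝ) ^ (i + 1) * r) - Φ ((2 : ℝ) ^ i * r)) := Finset.sum_le_sum fun i _ => hterm i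
    _ = 4 * b / (b - 1) * r ^ α * (Φ ((2 : ℝ) ^ N * r) - Φ ((2 : ℝ) ^ 0 * r)) := by
        rw [← Finset.mul_sum, Finset.sum_range_sub fun i => Φ ((2 : ℝ) ^ i * r)]
    _ ≤ 4 * b / (b - 1) * r ^ α * 1 := by
        gcongr
        linarith [(hΦ1 ((2 : ℝ) ^ N * r) (by positivity)).2,
          (hΦ1 ((2 : ℝ) ^ 0 * r) (by positivity)).1]
    _ = _ := mul_one _

end

section

variable {n : ℕ} (P : ParabolicLP n)

lemma exists_norm_le (f : 𝓢(Rn1 n, ℂ)) : ∃ M : ℝ, ∀ x, ‖f x‖ ≤ M :=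
  ⟨_, fun x => SchwartzMap.norm_le_seminorm ℝ f x⟩

/-- The dilates of `ψ` form an approximate identity. -/
lemma tendsto_convS_psS (f : 𝓢(Rn1 n, ℂ)) (x : Rn1 n) :
    Filter.Tendsto (fun N => convS (psS P N) f x) Filter.atTop (nhds (f x)) := by
  have e : ∀ N, convS (psS P N) f x =
      ∫ z, P.ψ z * f (x - dl ((2 : ℝ) ^ N)⁻¹ z) := by
    intro N
    rw [convS_apply, psS, conv1_ndS, conv1,
      ← integral_sub_left_eq_self _ volume (dl ((2 : ℝ) ^ N) x)]
    simp only [sub_sub_cancel, dilS_apply, dl_sub, dl_dl,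
      inv_mul_cancel₀ (pow_ne_zero N (two_ne_zero' ℝ)), dl_one]
  have hint : ∫ z, P.ψ z * f x = f x := by
    have h0 := FT1_psi_zero P
    simp only [FT1, Prod.fst_zero, Prod.snd_zero, PiLp.zero_apply, mul_zero,
      Finset.sum_const_zero, add_zero, Complex.ofReal_zero, Complex.exp_zero, one_mul] at h0
    rw [integral_mul_const, h0, one_mul]
  simp only [e]
  conv => rhs; rw [← hint]
  obtain ⟨M, hM⟩ := exists_norm_le f
  refine tendsto_integral_of_dominated_convergence (fun z => ‖P.ψ z‖ * M) (fun N => ?_)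
    (P.ψ.integrable.norm.mul_const M) (fun N => Filter.Eventually.of_forall fun z => ?_)
    (Filter.Eventually.of_forall fun z => ?_)
  · refine (P.ψ.continuous.mul (f.continuous.comp (continuous_const.sub ?_))).aestronglyMeasurable
    unfold dl
    fun_prop
  · rw [norm_mul]
    exact mul_le_mul_of_nonneg_left (hM _) (norm_nonneg _)
  · refine Filter.Tendsto.const_mul _ ((f.continuous.tendsto x).comp ?_)
    have h1 : Filter.Tendsto (fun N : ℕ => ((2 : ℝ) ^ N)⁻¹) Filter.atTop (nhds 0) :=
      tendsto_inv_atTop_zero.comp (tendsto_pow_atTop_atTop_of_one_lt (by norm_num))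
    have h2 : Continuous fun l : ℝ => x - dl l z := by unfold dl; fun_prop
    have e0 : x - dl 0 z = x := by ext <;> simp [dl]
    have := (h2.tendsto 0).comp h1
    rw [e0] at this
    exact this

/-- The spectral blocks `ψ, φ_1, φ_2, …`. -/
def block : ℕ → 𝓢(Rn1 n, ℂ)
  | 0 => P.ψ
  | i + 1 => phS P (i + 1)

lemma psS_eq_sum (N : ℕ) : psS P N = ∑ i ∈ Finset.range (N + 1), block P i := by
  induction N with
  | zero => simp [psS_zero, block]
  | succ N ih => rw [psS_succ, Finset.sum_range_succ, ← ih]; rfl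

lemma convS_sum_left {ι : Type*} (s : Finset ι) (g : ι → 𝓢(Rn1 n, ℂ)) (f : 𝓢(Rn1 n, ℂ)) :
    convS (∑ i ∈ s, g i) f = ∑ i ∈ s, convS (g i) f :=
  FT1_injective fun q => by simp only [FT1_convS, FT1_sum, Finset.sum_mul]

lemma tendsto_sum_blocks (f : 𝓢(Rn1 n, ℂ)) (x : Rn1 n) :
    Filter.Tendsto (fun N => ∑ i ∈ Finset.range (N + 1), convS (block P i) f x)
      Filter.atTop (nhds (f x)) := by
  have := tendsto_convS_psS P f x
  simpa only [psS_eq_sum, convS_sum_left, sum_apply] using this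

lemma block_eq_ndS (i : ℕ) : ∃ g : 𝓢(Rn1 n, ℂ), (∀ q, 2 ≤ rho q → FT1 (⇑g) q = 0) ∧
    block P i = ndS ((2 : ℝ) ^ i) (by positivity) g := by
  cases i with
  | zero => exact ⟨P.ψ, fun q h => FT1_psi_eq_zero P h, (psS_zero P).symm⟩
  | succ i => exact ⟨P.φ, fun q h => FT1_phi_eq_zero P fun h' => by linarith [h'.2], rfl⟩

lemma dl_inv_dl {l : ℝ} (hl : 0 < l) (x : Rn1 n) : dl l (dl l⁻¹ x) = x := by
  rw [dl_dl, mul_inv_cancel₀ hl.ne', dl_one]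

lemma exists_bernstein_block (n : ℕ) : ∃ C : ℝ, 4 ≤ C ∧ ∀ (P : ParabolicLP n) (i : ℕ)
    (f : 𝓢(Rn1 n, ℂ)) (M : ℝ), (∀ x, ‖convS (block P i) f x‖ ≤ M) → ∀ h x : Rn1 n,
      ‖diff1 h (convS (block P i) f) x‖ ≤ C * min 1 ‖dl ((2 : ℝ) ^ i) h‖ * M ∧
      ‖diff2 h (convS (block P i) f) x‖ ≤ C * min 1 (‖dl ((2 : ℝ) ^ i) h‖ ^ 2) * M := by
  obtain ⟨K, hK⟩ := exists_reproducing_kernel n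
  obtain ⟨C, hC, hB⟩ := exists_bernstein K
  refine ⟨C, hC, fun P i f M hM h x => ?_⟩
  obtain ⟨g, hg, hgi⟩ := block_eq_ndS P i
  have hl : (0 : ℝ) < 2 ^ i := by positivity
  set u := convS g (dilS ((2 : ℝ) ^ i)⁻¹ (inv_pos.2 hl) f) with hu
  have hU : ∀ y, convS (block P i) f y = u (dl ((2 : ℝ) ^ i) y) := by
    intro y
    rw [hgi, convS_apply, conv1_ndS, hu, convS_apply]
  have hMu : ∀ y, ‖u y‖ ≤ M := by
    intro y
    have := hM (dl ((2 : ℝ) ^ i)⁻¹ y)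
    rwa [hU, dl_inv_dl hl] at this
  have := hB u (hK g _ hg) M hMu (dl ((2 : ℝ) ^ i) h) (dl ((2 : ℝ) ^ i) x)
  simpa only [diff1_apply, diff2_apply, hU, dl_add, dl_sub] using this

/-- Besov control implies Hölder–Zygmund control. -/
lemma exists_holder_bound {α : ℝ} (hα0 : 0 < α) (hα2 : α < 2) : ∃ C : ℝ, 0 < C ∧
    ∀ (f : 𝓢(Rn1 n, ℂ)) (M : ℝ), 0 ≤ M →
      (∀ i x, ‖convS (block P i) f x‖ ≤ ((2 : ℝ) ^ i) ^ (-α) * M) →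
      (∀ x, ‖f x‖ ≤ C * M) ∧ (∀ x s, ‖diff1 (0, s) f x‖ ≤ C * M * |s| ^ (α / 2)) ∧
      (∀ x Y, ‖diff2 (Y, 0) f x‖ ≤ C * M * ‖Y‖ ^ α) := by
  obtain ⟨B, hB4, hB⟩ := exists_bernstein_block n
  obtain ⟨S, hS0, hS⟩ := exists_dyadic_sum_bound hα0 hα2
  refine ⟨B * S, by positivity, fun f M hM0 hM => ?_⟩
  have key : ∀ (a : ℂ) (w : ℕ → ℂ) (r : ℝ), 0 ≤ r →
      Filter.Tendsto (fun N => ∑ i ∈ Finset.range (N + 1), w i) Filter.atTop (nhds a) →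
      (∀ i, ‖w i‖ ≤ B * min 1 (((2 : ℝ) ^ i * r) ^ 2) * (((2 : ℝ) ^ i) ^ (-α) * M)) →
      ‖a‖ ≤ B * S * M * r ^ α := by
    intro a w r hr ht hw
    refine le_of_tendsto' ht.norm fun N => (norm_sum_le _ _).trans ?_
    calc _ ≤ ∑ i ∈ Finset.range (N + 1),
          B * M * (((2 : ℝ) ^ i) ^ (-α) * min 1 (((2 : ℝ) ^ i * r) ^ 2)) :=
          Finset.sum_le_sum fun i _ => (hw i).trans_eq (by ring)
      _ ≤ B * M * (S * r ^ α) := by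
          rw [← Finset.mul_sum]
          exact mul_le_mul_of_nonneg_left (hS r hr _) (by positivity)
      _ = _ := by ring
  refine ⟨fun x => ?_, fun x s => ?_, fun x Y => ?_⟩
  · have := key (f x) (fun i => convS (block P i) f x) 1 zero_le_one (tendsto_sum_blocks P f x)
      fun i => by
        have h1 : (1 : ℝ) ≤ ((2 : ℝ) ^ i * 1) ^ 2 := by
          rw [mul_one]
          exact one_le_pow₀ (one_le_pow₀ (by norm_num))
        rw [min_eq_left h1, mul_one]
        have h2 : 0 ≤ ((2 : ℝ) ^ i) ^ (-α) * M := by positivity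
        nlinarith [hM i x]
    simpa using this
  · have ht := (tendsto_sum_blocks P f (x + (0, s))).sub (tendsto_sum_blocks P f x)
    simp only [← Finset.sum_sub_distrib, ← diff1_apply] at ht
    have := key _ _ (|s| ^ ((1 : ℝ) / 2)) (by positivity) ht fun i => by
      refine ((hB P i f _ (hM i) _ x).1).trans_eq ?_
      congr 3
      rw [mul_pow, ← Real.sqrt_eq_rpow, Real.sq_sqrt (abs_nonneg s)]
      simp [dl, Prod.norm_def]
      positivity
    rw [← Real.rpow_mul (abs_nonneg s)] at this
    convert! this using 3
    ring
  · have ht := (((tendsto_sum_blocks P f x).const_mul 2)).sub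
      ((tendsto_sum_blocks P f (x + (Y, 0))).add (tendsto_sum_blocks P f (x - (Y, 0))))
    simp only [Finset.mul_sum, ← Finset.sum_add_distrib, ← Finset.sum_sub_distrib,
      ← diff2_apply] at ht
    exact key _ _ ‖Y‖ (norm_nonneg _) ht fun i => by
      refine ((hB P i f _ (hM i) _ x).2).trans_eq ?_
      congr 4
      simp [dl, Prod.norm_def, norm_smul]

/-- Hölder–Zygmund control implies Besov control. -/
lemma exists_besov_bound {α : ℝ} (hα0 : 0 < α) : ∃ C : ℝ, 0 < C ∧
    ∀ (f : 𝓢(Rn1 n, ℂ)) (M : ℝ), 0 ≤ M → (∀ x, ‖f x‖ ≤ M) →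
      (∀ x s, ‖diff1 (0, s) f x‖ ≤ M * |s| ^ (α / 2)) →
      (∀ x Y, ‖diff2 (Y, 0) f x‖ ≤ M * ‖Y‖ ^ α) →
      (∀ i x, ‖convS (block P i) f x‖ ≤ ((2 : ℝ) ^ i) ^ (-α) * (C * M)) := by
  obtain ⟨A, hA⟩ := exists_phi_factor P
  set a := ∫ y, ‖A y‖ with ha
  set p := ∫ y, ‖P.ψ y‖ with hp
  have ha0 : 0 ≤ a := integral_nonneg fun _ => norm_nonneg _
  have hp0 : 0 ≤ p := integral_nonneg fun _ => norm_nonneg _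
  refine ⟨p + a * (n + 2) + 1, by positivity, fun f M hM0 hf h1 h2 i x => ?_⟩
  cases i with
  | zero =>
    refine (norm_convS_le _ f hf x).trans ?_
    simp only [pow_zero, Real.one_rpow, one_mul]
    refine mul_le_mul_of_nonneg_right ?_ hM0
    have : 0 ≤ a * (n + 2) := by positivity
    change p ≤ _
    linarith
  | succ j =>
    set i := j + 1
    set l : ℝ := 2 ^ i with hldef
    have hl : 0 < l := by positivity
    set g := dilS l⁻¹ (inv_pos.2 hl) f with hg
    have hlα : 0 < l ^ (-α) := Real.rpow_pos_of_pos hl _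
    have hd : ∀ v y, diff2 v g y = diff2 (dl l⁻¹ v) f (dl l⁻¹ y) := by
      intro v y
      simp only [diff2_apply, hg, dilS_apply, dl_add, dl_sub]
    have hX : ∀ k y, ‖diff2 (vX k) g y‖ ≤ l ^ (-α) * M := by
      intro k y
      rw [hd]
      have e : dl l⁻¹ (vX k : Rn1 n) = (l⁻¹ • EuclideanSpace.single k (1 / 4 : ℝ), 0) := by
        simp [dl, vX]
      rw [e]
      refine (h2 _ _).trans ?_
      rw [mul_comm, Real.rpow_neg hl.le, ← Real.inv_rpow hl.le]
      gcongr
      rw [norm_smul, PiLp.norm_single, Real.norm_eq_abs, abs_of_pos (inv_pos.2 hl)]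
      have : 0 < l⁻¹ := inv_pos.2 hl
      norm_num
      linarith
    have hT : ∀ y, ‖diff2 vT g y‖ ≤ 2 * (l ^ (-α) * M) := by
      intro y
      rw [hd]
      have e : dl l⁻¹ (vT : Rn1 n) = (0, l⁻¹ ^ 2 * (1 / 8)) := by
        simp [dl, vT]
      rw [e]
      set s : ℝ := l⁻¹ ^ 2 * (1 / 8)
      set z := dl l⁻¹ y
      have hs : |s| ^ (α / 2) ≤ l ^ (-α) := by
        have : |s| ≤ l⁻¹ ^ 2 := by
          rw [abs_of_nonneg (by positivity)]
          have : 0 ≤ l⁻¹ ^ 2 := by positivity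
          simp only [s]
          linarith
        calc |s| ^ (α / 2) ≤ (l⁻¹ ^ 2) ^ (α / 2) := by gcongr
          _ = l ^ (-α) := by
            rw [← Real.rpow_two, ← Real.rpow_mul (by positivity), Real.inv_rpow hl.le,
              ← Real.rpow_neg hl.le]
            congr 2
            ring
      have h3 := h1 z s
      have h4 := h1 z (-s)
      have e2 : diff2 (0, s) f z = -(diff1 (0, s) f z + diff1 (0, -s) f z) := by
        simp only [diff2_apply, diff1_apply]
        have : z - (0, s) = z + (0, -s) := by rw [sub_eq_add_neg]; simp
        rw [this]
        ring
      rw [e2, norm_neg]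
      rw [abs_neg] at h4
      have h5 : M * |s| ^ (α / 2) ≤ M * l ^ (-α) := by gcongr
      refine (norm_add_le _ _).trans ?_
      linarith
    have e : convS (block P i) f x = convS P.φ g (dl l x) := by
      rw [convS_apply, convS_apply]
      exact conv1_ndS _ _ _ _ _
    rw [e, hA, add_apply, sum_apply]
    calc _ ≤ ∑ k : Fin n, a * (l ^ (-α) * M) + a * (2 * (l ^ (-α) * M)) := by
          refine (norm_add_le _ _).trans (add_le_add ((norm_sum_le _ _).trans ?_) ?_)
          · exact Finset.sum_le_sum fun k _ => norm_convS_le _ _ (hX k) _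
          · exact norm_convS_le _ _ hT _
      _ = l ^ (-α) * (a * (n + 2) * M) := by
          simp only [Finset.sum_const, Finset.card_univ, Fintype.card_fin, nsmul_eq_mul]
          ring
      _ ≤ _ := by
          gcongr
          linarith

end

section

variable {n : ℕ} (P : ParabolicLP n)

lemma norm_le_of_eLpNorm_top_le (f : 𝓢(Rn1 n, ℂ)) {M : ℝ} (hM : 0 ≤ M)
    (h : eLpNorm (⇑f) ⊤ volume ≤ ENNReal.ofReal M) (x : Rn1 n) : ‖f x‖ ≤ M := by
  have hae : ∀ᵐ y ∂(volume : Measure (Rn1 n)), f y ∈ Metric.closedBall (0 : ℂ) M := by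
    rw [eLpNorm_exponent_top] at h
    filter_upwards [ae_le_eLpNormEssSup (f := ⇑f) (μ := volume)] with y hy
    have := hy.trans h
    rw [← ofReal_norm, ENNReal.ofReal_le_ofReal_iff hM] at this
    simpa using this
  have hd : Dense {y | f y ∈ Metric.closedBall (0 : ℂ) M} := Measure.dense_of_ae hae
  have hc : IsClosed {y | f y ∈ Metric.closedBall (0 : ℂ) M} :=
    Metric.isClosed_closedBall.preimage f.continuous
  have hx : x ∈ {y | f y ∈ Metric.closedBall (0 : ℂ) M} := hc.closure_eq ▸ hd x
  simpa using hx

lemma eLpNorm_top_le_of_norm_le {f : Rn1 n → ℂ} {M : ℝ} (h : ∀ x, ‖f x‖ ≤ M) :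
    eLpNorm f ⊤ volume ≤ ENNReal.ofReal M := by
  rw [eLpNorm_exponent_top]
  exact eLpNormEssSup_le_of_ae_bound (Filter.Eventually.of_forall h)

lemma pBesovInf_le_iff {α M : ℝ} (hM : 0 ≤ M) (f : 𝓢(Rn1 n, ℂ)) :
    pBesovInf P α ⇑f ≤ ENNReal.ofReal M ↔
      ∀ i x, ‖convS (block P i) f x‖ ≤ ((2 : ℝ) ^ i) ^ (-α) * M := by
  have hz : eLpNorm (conv1 (⇑P.ψ) ⇑f) ⊤ volume ≤ ENNReal.ofReal M ↔
      ∀ x, ‖convS (block P 0) f x‖ ≤ ((2 : ℝ) ^ 0) ^ (-α) * M := by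
    rw [← coe_convS, pow_zero, Real.one_rpow, one_mul]
    exact ⟨fun h => norm_le_of_eLpNorm_top_le _ hM h, eLpNorm_top_le_of_norm_le⟩
  have hs : ∀ i : ℕ, ENNReal.ofReal ((2 : ℝ) ^ (α * ((i : ℝ) + 1))) *
      eLpNorm (conv1 (lpPhi P (i + 1)) ⇑f) ⊤ volume ≤ ENNReal.ofReal M ↔
      ∀ x, ‖convS (block P (i + 1)) f x‖ ≤ ((2 : ℝ) ^ (i + 1)) ^ (-α) * M := by
    intro i
    have hp : (0 : ℝ) < 2 ^ (α * ((i : ℝ) + 1)) := by positivity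
    have e : ((2 : ℝ) ^ (i + 1)) ^ (-α) * M = M / 2 ^ (α * ((i : ℝ) + 1)) := by
      rw [← Real.rpow_natCast, ← Real.rpow_mul (by norm_num), div_eq_inv_mul,
        ← Real.rpow_neg (by norm_num)]
      push_cast
      ring_nf
    rw [← coe_phS, ← coe_convS, e, mul_comm,
      ← ENNReal.le_div_iff_mul_le (.inl (ENNReal.ofReal_pos.2 hp).ne') (.inl ENNReal.ofReal_ne_top),
      ← ENNReal.ofReal_div_of_pos hp]
    exact ⟨fun h => norm_le_of_eLpNorm_top_le _ (by positivity) h, eLpNorm_top_le_of_norm_le⟩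
  rw [pBesovInf, max_le_iff, iSup_le_iff, hz]
  simp only [hs]
  exact ⟨fun h i => by cases i with | zero => exact h.1 | succ i => exact h.2 i,
    fun h => ⟨h 0, fun i => h (i + 1)⟩⟩

lemma ofReal_div_rpow_le_iff {a r β M : ℝ} (hr : 0 ≤ r) (hβ : 0 < β) (hM : 0 ≤ M)
    (h0 : r = 0 → a = 0) :
    ENNReal.ofReal (a / r ^ β) ≤ ENNReal.ofReal M ↔ a ≤ M * r ^ β := by
  rw [ENNReal.ofReal_le_ofReal_iff hM]
  rcases hr.eq_or_lt with rfl | hr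
  · simp [h0 rfl, Real.zero_rpow hβ.ne', hM]
  · exact div_le_iff₀ (Real.rpow_pos_of_pos hr _)

lemma iSup_timeQuotient_le_iff {α M : ℝ} (hα : 0 < α) (hM : 0 ≤ M) (f : 𝓢(Rn1 n, ℂ)) :
    (⨆ X : Rn n, ⨆ t : ℝ, ⨆ s : ℝ,
        ENNReal.ofReal (‖f (X, t) - f (X, s)‖ / |t - s| ^ (α / 2))) ≤ ENNReal.ofReal M ↔
      ∀ x s, ‖diff1 (0, s) f x‖ ≤ M * |s| ^ (α / 2) := by
  have key : ∀ (X : Rn n) (t s : ℝ),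
      ENNReal.ofReal (‖f (X, t) - f (X, s)‖ / |t - s| ^ (α / 2)) ≤ ENNReal.ofReal M ↔
        ‖diff1 (0, t - s) f (X, s)‖ ≤ M * |t - s| ^ (α / 2) := fun X t s => by
    rw [ofReal_div_rpow_le_iff (abs_nonneg _) (by positivity) hM fun h => by
      rw [sub_eq_zero.1 (abs_eq_zero.1 h), sub_self, norm_zero]]
    simp [diff1_apply]
  simp only [iSup_le_iff, key]
  exact ⟨fun h x s => by simpa using h x.1 (x.2 + s) x.2, fun h X t s => h (X, s) (t - s)⟩

lemma iSup_spaceQuotient_le_iff {α M : ℝ} (hα : 0 < α) (hM : 0 ≤ M) (f : 𝓢(Rn1 n, ℂ)) :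
    (⨆ X : Rn n, ⨆ t : ℝ, ⨆ Y : Rn n,
        ENNReal.ofReal (‖f (X + Y, t) - 2 * f (X, t) + f (X - Y, t)‖ / ‖Y‖ ^ α)) ≤
        ENNReal.ofReal M ↔
      ∀ x Y, ‖diff2 (Y, 0) f x‖ ≤ M * ‖Y‖ ^ α := by
  have key : ∀ (X : Rn n) (t : ℝ) (Y : Rn n),
      ENNReal.ofReal (‖f (X + Y, t) - 2 * f (X, t) + f (X - Y, t)‖ / ‖Y‖ ^ α) ≤
        ENNReal.ofReal M ↔ ‖diff2 (Y, 0) f (X, t)‖ ≤ M * ‖Y‖ ^ α := fun X t Y => by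
    rw [ofReal_div_rpow_le_iff (norm_nonneg _) hα hM fun h => by
      rw [norm_eq_zero.1 h, add_zero, sub_zero, norm_eq_zero]; ring,
      diff2_apply, ← norm_neg (2 * f (X, t) - _)]
    simp only [Prod.mk_add_mk, Prod.mk_sub_mk, add_zero, sub_zero]
    rw [show -(2 * f (X, t) - (f (X + Y, t) + f (X - Y, t))) =
      f (X + Y, t) - 2 * f (X, t) + f (X - Y, t) by ring]
  simp only [iSup_le_iff, key, Prod.forall]

lemma le_ofReal_mul_of_forall {a b : ℝ≥0∞} {C : ℝ} (hC : 0 < C)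
    (h : ∀ M : ℝ, 0 ≤ M → b ≤ ENNReal.ofReal M → a ≤ ENNReal.ofReal (C * M)) :
    a ≤ ENNReal.ofReal C * b := by
  rcases eq_or_ne b ⊤ with rfl | hb
  · rw [ENNReal.mul_top (ENNReal.ofReal_pos.2 hC).ne']
    exact le_top
  · have := h b.toReal ENNReal.toReal_nonneg (ENNReal.ofReal_toReal hb).ge
    rwa [ENNReal.ofReal_mul hC.le, ENNReal.ofReal_toReal hb] at this

end

end

/-- For `0 < α < 2`, the parabolic Besov norm `N_{α,∞}` is equivalent to the
Hölder-type norm of second differences. -/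
theorem stmt9 (n : ℕ) (hn : 1 ≤ n) (α : ℝ) (hα0 : 0 < α) (hα2 : α < 2) (P : ParabolicLP n) :
    ∃ c C : ℝ, 0 < c ∧ 0 < C ∧
      ∀ f : SchwartzMap (Rn1 n) ℂ,
        ENNReal.ofReal c * pBesovInf P α ⇑f ≤
            eLpNorm (⇑f) ⊤ volume
            + (⨆ X : Rn n, ⨆ t : ℝ, ⨆ s : ℝ,
                ENNReal.ofReal (‖f (X, t) - f (X, s)‖ / |t - s| ^ (α / 2)))
            + (⨆ X : Rn n, ⨆ t : ℝ, ⨆ Y : Rn n,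
                ENNReal.ofReal (‖f (X + Y, t) - 2 * f (X, t) + f (X - Y, t)‖ / ‖Y‖ ^ α))
          ∧
          eLpNorm (⇑f) ⊤ volume
            + (⨆ X : Rn n, ⨆ t : ℝ, ⨆ s : ℝ,
                ENNReal.ofReal (‖f (X, t) - f (X, s)‖ / |t - s| ^ (α / 2)))
            + (⨆ X : Rn n, ⨆ t : ℝ, ⨆ Y : Rn n,
                ENNReal.ofReal (‖f (X + Y, t) - 2 * f (X, t) + f (X - Y, t)‖ / ‖Y‖ ^ α))
            ≤ ENNReal.ofReal C * pBesovInf P α ⇑f := by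
  obtain ⟨A, hA0, hA⟩ := exists_holder_bound P hα0 hα2
  obtain ⟨B, hB0, hB⟩ := exists_besov_bound P hα0
  refine ⟨B⁻¹, 3 * A, by positivity, by positivity, fun f => ⟨?_, ?_⟩⟩
  · rw [ENNReal.ofReal_inv_of_pos hB0,
      ENNReal.inv_mul_le_iff (ENNReal.ofReal_pos.2 hB0).ne' ENNReal.ofReal_ne_top]
    refine le_ofReal_mul_of_forall hB0 fun M hM h => ?_
    have h12 := le_self_add.trans h
    exact (pBesovInf_le_iff P (by positivity) f).2 <| hB f M hM
      (norm_le_of_eLpNorm_top_le f hM (le_self_add.trans h12))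
      ((iSup_timeQuotient_le_iff hα0 hM f).1 (le_add_self.trans h12))
      ((iSup_spaceQuotient_le_iff hα0 hM f).1 (le_add_self.trans h))
  · refine le_ofReal_mul_of_forall (by positivity) fun M hM h => ?_
    obtain ⟨h1, h2, h3⟩ := hA f M hM ((pBesovInf_le_iff P hM f).1 h)
    have hAM : 0 ≤ A * M := by positivity
    rw [show 3 * A * M = A * M + A * M + A * M by ring, ENNReal.ofReal_add (by positivity) hAM,
      ENNReal.ofReal_add hAM hAM]
    gcongr
    · exact eLpNorm_top_le_of_norm_le h1
    · exact (iSup_timeQuotient_le_iff hα0 hAM f).2 h2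
    · exact (iSup_spaceQuotient_le_iff hα0 hAM f).2 h3
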